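/- arXiv:1001.2942 — 4 statements merged into one kernel-verified Lean document; each statement's English description precedes it below -/
import Mathlib

section
/- For every n ≥ 3, F̂_3^n(0) = max{ |F̂_3^n(c)| : c ∈ F_2^n }, where 0 denotes the zero vector of F_2^n. -/
/-- Dot product on `F_2^n`. -/
def dotp (n : ℕ) (c x : Fin n → ZMod 2) : ZMod 2 := ∑ i, c i * x i

/-- Fourier transform of a Boolean function `f : F_2^n → F_2` at `c ∈ F_2^n`. -/
def walsh (n : ℕ) (f : (Fin n → ZMod 2) → ZMod 2) (c : Fin n → ZMod 2) : ℤ :=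
  ∑ x : Fin n → ZMod 2, (-1 : ℤ) ^ (f x + dotp n c x).val

/-- The rotation symmetric function `F_3^n(x) = Σ_i x_i x_{i+1 mod n} x_{i+2 mod n}`. -/
def F3 (n : ℕ) (x : Fin n → ZMod 2) : ZMod 2 :=
  ∑ i : Fin n, x i * x ⟨(i.val + 1) % n, Nat.mod_lt _ i.pos⟩
    * x ⟨(i.val + 2) % n, Nat.mod_lt _ i.pos⟩

/-- `t_m(x) = Σ_{i=0}^{m-3} x_i x_{i+1} x_{i+2}`. -/
def tm (m : ℕ) (x : Fin m → ZMod 2) : ZMod 2 :=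
  ∑ i ∈ Finset.range m,
    if h : i + 2 < m then x ⟨i, by omega⟩ * x ⟨i + 1, by omega⟩ * x ⟨i + 2, by omega⟩ else 0

/-- `f_0^m = t_m`. -/
def f0 (m : ℕ) (x : Fin m → ZMod 2) : ZMod 2 := tm m x

/-- `f_1^m = t_m + x_0 x_1`. -/
def f1 (m : ℕ) (x : Fin m → ZMod 2) : ZMod 2 :=
  if h : 2 ≤ m then tm m x + x ⟨0, by omega⟩ * x ⟨1, by omega⟩ else 0

/-- `f_2^m = t_m + x_{m-2} x_{m-1}`. -/
def f2 (m : ℕ) (x : Fin m → ZMod 2) : ZMod 2 :=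
  if h : 2 ≤ m then tm m x + x ⟨m - 2, by omega⟩ * x ⟨m - 1, by omega⟩ else 0

/-- `f_3^m = t_m + x_0 x_1 + x_{m-2} x_{m-1} + x_0 + x_{m-1}`. -/
def f3 (m : ℕ) (x : Fin m → ZMod 2) : ZMod 2 :=
  if h : 2 ≤ m then
    tm m x + x ⟨0, by omega⟩ * x ⟨1, by omega⟩ + x ⟨m - 2, by omega⟩ * x ⟨m - 1, by omega⟩
      + x ⟨0, by omega⟩ + x ⟨m - 1, by omega⟩
  else 0

/-- `c^m`: the vector of the first `m` coordinates of `c ∈ F_2^n`. -/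
def trunc {n : ℕ} (m : ℕ) (h : m ≤ n) (c : Fin n → ZMod 2) : Fin m → ZMod 2 :=
  fun i => c (Fin.castLE h i)

/-- `e_1 = (1,0,…,0) ∈ F_2^m`. -/
def eOne (m : ℕ) : Fin m → ZMod 2 := fun i => if i.val = 0 then 1 else 0

/-- `e_{2^{m-1}} = (0,…,0,1) ∈ F_2^m`. -/
def eLast (m : ℕ) : Fin m → ZMod 2 := fun i => if i.val = m - 1 then 1 else 0

/-- The weight of a Boolean function: the number of `x` with `f x = 1`. -/
def wt (n : ℕ) (f : (Fin n → ZMod 2) → ZMod 2) : ℕ :=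
  (Finset.univ.filter fun x => f x = 1).card

/-- One transfer step, acting on the triple of chain sums started from the states
`{00, 10}`, `01`, `11`. -/
def transfer (s : ℤ) (r : ℤ × ℤ × ℤ) : ℤ × ℤ × ℤ :=
  (r.1 + s * r.2.1, r.1 + s * r.2.2, r.1 - s * r.2.2)

/-- The triple of chain sums along the word of signs `l` with terminal data `e`. -/
def col (e : ℤ × ℤ × ℤ) (l : List ℤ) : ℤ × ℤ × ℤ := l.foldr transfer e

/-- Terminal data of the states `{00, 01}`. -/
def endU : ℤ × ℤ × ℤ := (1, 1, 1)

/-- Terminal data of the state `10`. -/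
def endV : ℤ × ℤ × ℤ := (1, 1, -1)

/-- Terminal data of the state `11`. -/
def endW : ℤ × ℤ × ℤ := (1, -1, 1)

@[simp] lemma col_nil (e : ℤ × ℤ × ℤ) : col e [] = e := rfl

@[simp] lemma col_cons (e : ℤ × ℤ × ℤ) (s : ℤ) (l : List ℤ) :
    col e (s :: l) = transfer s (col e l) := rfl

lemma col_append_singleton (l : List ℤ) (s : ℤ) :
    col endU (l ++ [s]) = col endU l + s • col endV l ∧
    col endV (l ++ [s]) = col endU l + s • col endW l ∧
    col endW (l ++ [s]) = col endU l - s • col endW l := by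
  induction l with
  | nil => simp [transfer, endU, endV, endW, sub_eq_add_neg]
  | cons t l ih =>
    obtain ⟨h1, h2, h3⟩ := ih
    simp only [List.cons_append, col_cons, h1, h2, h3]
    refine ⟨?_, ?_, ?_⟩ <;> ext <;> simp [transfer] <;> ring

/-- The words of length `k` in the signs `±1`. -/
def words : ℕ → List (List ℤ)
  | 0 => [[]]
  | k + 1 => (words k).flatMap fun l => [1 :: l, -1 :: l]

/-- A list of signs. -/
def IsWord (l : List ℤ) : Prop := ∀ s ∈ l, s = 1 ∨ s = -1

lemma isWord_cons {s : ℤ} {l : List ℤ} : IsWord (s :: l) ↔ (s = 1 ∨ s = -1) ∧ IsWord l := by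
  simp [IsWord]

lemma IsWord.mem_words {l : List ℤ} (hl : IsWord l) : l ∈ words l.length := by
  induction l with
  | nil => simp [words]
  | cons s l ih =>
    obtain ⟨hs, hl⟩ := isWord_cons.1 hl
    simp only [words, List.length_cons, List.mem_flatMap]
    exact ⟨l, ih hl, by rcases hs with rfl | rfl <;> simp⟩

/-- All components of a triple are bounded by `b` in absolute value. -/
def BoundedBy (b : ℤ) (r : ℤ × ℤ × ℤ) : Prop := |r.1| ≤ b ∧ |r.2.1| ≤ b ∧ |r.2.2| ≤ b

instance (b : ℤ) (r : ℤ × ℤ × ℤ) : Decidable (BoundedBy b r) :=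
  inferInstanceAs (Decidable (_ ∧ _ ∧ _))

lemma boundedBy_transfer_transfer_transfer {p q s b₀ b₁ : ℤ} {r : ℤ × ℤ × ℤ}
    (hp : p = 1 ∨ p = -1) (hq : q = 1 ∨ q = -1) (hs : s = 1 ∨ s = -1)
    (h₀ : BoundedBy b₀ r) (h₁ : BoundedBy b₁ (transfer s r)) :
    BoundedBy (2 * b₁ + 2 * b₀) (transfer p (transfer q (transfer s r))) := by
  obtain ⟨u, v, w⟩ := r
  simp only [BoundedBy, transfer, abs_le] at *
  rcases hp with rfl | rfl <;> rcases hq with rfl | rfl <;> rcases hs with rfl | rfl <;> omega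

/-- The growth of the chain sums propagates along the word. -/
lemma boundedBy_col {e : ℤ × ℤ × ℤ} {g : ℕ → ℤ} {K : ℕ}
    (hg : ∀ k, g (k + 3) = 2 * g (k + 1) + 2 * g k)
    (base : ∀ k < 3, ∀ l ∈ words (K + k), BoundedBy (g k) (col e l)) (k : ℕ) :
    ∀ l, IsWord l → l.length = K + k → BoundedBy (g k) (col e l) := by
  induction k using Nat.strong_induction_on with
  | _ k ih =>
    intro l hl hk
    rcases Nat.lt_or_ge k 3 with h3 | h3
    · exact base k h3 l (hk ▸ hl.mem_words)
    obtain ⟨k, rfl⟩ := Nat.exists_eq_add_of_le' h3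
    match l, hl, hk with
    | p :: q :: s :: l, hl, hk =>
      simp only [isWord_cons] at hl
      simp only [List.length_cons] at hk
      obtain ⟨hp, hq, hs, hl⟩ := hl
      rw [hg]
      exact boundedBy_transfer_transfer_transfer hp hq hs
        (ih k (by omega) l hl (by omega))
        (ih (k + 1) (by omega) (s :: l) (isWord_cons.2 ⟨hs, hl⟩) (by simp; omega))
    | [], _, hk => simp at hk
    | [_], _, hk => simp at hk; omega
    | [_, _], _, hk => simp at hk; omega

/-- The chain sum of `t_k`. -/
def chainSum : ℕ → ℤ
  | 0 => 1
  | 1 => 2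
  | 2 => 4
  | k + 3 => 2 * chainSum (k + 1) + 2 * chainSum k

lemma chainSum_add_three (k : ℕ) :
    chainSum (k + 3) = 2 * chainSum (k + 1) + 2 * chainSum k := rfl

/-- The increments of `chainSum`. -/
def chainInc (k : ℕ) : ℤ := chainSum (k + 1) - chainSum k

lemma chainSum_nonneg : ∀ k, 0 ≤ chainSum k
  | 0 => by decide
  | 1 => by decide
  | 2 => by decide
  | k + 3 => by
    have := chainSum_nonneg k
    have := chainSum_nonneg (k + 1)
    rw [chainSum_add_three]; omega

lemma chainInc_add_four (k : ℕ) :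
    chainInc (k + 4) = 2 * chainSum (k + 1) + 4 * chainSum k := by
  simp only [chainInc, chainSum_add_three]; ring

lemma two_mul_chainInc_le : ∀ k, 2 * chainInc (k + 4) + 2 * chainInc (k + 3)
    ≤ 2 * chainSum (k + 4) + chainSum (k + 3)
  | 0 => by decide
  | 1 => by decide
  | 2 => by decide
  | k + 3 => by
    have h1 := two_mul_chainInc_le k
    have h2 := two_mul_chainInc_le (k + 1)
    simp only [chainInc, chainSum_add_three] at *
    omega

lemma boundedBy_col_endU {l : List ℤ} (hl : IsWord l) :
    BoundedBy (chainSum l.length) (col endU l) :=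
  boundedBy_col (K := 0) chainSum_add_three (by decide) _ l hl (by simp)

lemma boundedBy_col_endW {k : ℕ} {l : List ℤ} (hl : IsWord l) (hk : l.length = k + 3) :
    BoundedBy (chainInc (k + 3)) (col endW l) :=
  boundedBy_col (K := 3) (g := fun k => chainInc (k + 3))
    (fun k => by simp only [chainInc, chainSum_add_three]; ring) (by decide) k l hl (by omega)

lemma boundedBy_col_endV {k : ℕ} {l : List ℤ} (hl : IsWord l) (hk : l.length = k + 3) :
    BoundedBy (chainInc (k + 3)) (col endV l) :=
  boundedBy_col (K := 3) (g := fun k => chainInc (k + 3))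
    (fun k => by simp only [chainInc, chainSum_add_three]; ring) (by decide) k l hl (by omega)

/-- Chain sums started from `01` or `11` and ended in `{00, 01}` are at most `chainInc`. -/
lemma abs_col_endU_le {k : ℕ} {l : List ℤ} (hl : IsWord l) (hk : l.length = k + 3) :
    |(col endU l).2.1| ≤ chainInc (k + 3) ∧ |(col endU l).2.2| ≤ chainInc (k + 3) := by
  cases k with
  | zero =>
    have : ∀ l ∈ words 3, |(col endU l).2.1| ≤ chainInc 3 ∧ |(col endU l).2.2| ≤ chainInc 3 := by
      decide
    exact this l (by simpa [hk] using hl.mem_words)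
  | succ k =>
    match l, hl, hk with
    | p :: q :: s :: t :: l, hl, hk =>
      simp only [isWord_cons] at hl
      simp only [List.length_cons] at hk
      obtain ⟨hp, hq, hs, ht, hl⟩ := hl
      have h0 := boundedBy_col_endU hl
      have h1 := boundedBy_col_endU (isWord_cons.2 ⟨ht, hl⟩)
      rw [chainInc_add_four]
      obtain rfl : l.length = k := by omega
      rw [List.length_cons] at h1
      simp only [col_cons] at *
      generalize col endU l = r at *
      generalize chainSum _ = a at *
      generalize chainSum _ = b at *
      obtain ⟨u, v, w⟩ := r
      simp only [BoundedBy, transfer, abs_le] at *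
      rcases hp with rfl | rfl <;> rcases hq with rfl | rfl <;> rcases hs with rfl | rfl <;>
        rcases ht with rfl | rfl <;> omega
    | [], _, hk => simp at hk
    | [_], _, hk => simp at hk
    | [_, _], _, hk => simp at hk
    | [_, _, _], _, hk => simp at hk

lemma abs_add_abs_le_of {a b c : ℤ}
    (h : a + b ≤ c ∧ a - b ≤ c ∧ -a + b ≤ c ∧ -a - b ≤ c) : |a| + |b| ≤ c := by
  rcases abs_cases a with h1 | h1 <;> rcases abs_cases b with h2 | h2 <;> omega

set_option maxHeartbeats 1000000 in
lemma abs_col_endU_add_abs_col_endW_le {k : ℕ} {p₀ p₁ p₂ q₀ q₁ q₂ : ℤ} {l : List ℤ}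
    (hp₀ : p₀ = 1 ∨ p₀ = -1) (hp₁ : p₁ = 1 ∨ p₁ = -1) (hp₂ : p₂ = 1 ∨ p₂ = -1)
    (hq₀ : q₀ = 1 ∨ q₀ = -1) (hq₁ : q₁ = 1 ∨ q₁ = -1) (hq₂ : q₂ = 1 ∨ q₂ = -1)
    (hl : IsWord l) (hk : l.length = k + 3) :
    |(col endU (p₀ :: p₁ :: p₂ :: (l ++ [q₂] ++ [q₁] ++ [q₀]))).1|
      + |(col endW (p₀ :: p₁ :: p₂ :: (l ++ [q₂] ++ [q₁] ++ [q₀]))).2.2|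
      ≤ chainSum (k + 9) + 4 * chainSum (k + 3) := by
  have hq : IsWord (l ++ [q₂]) := by
    intro s hs
    rcases List.mem_append.1 hs with hs | hs
    · exact hl s hs
    · simpa [List.mem_singleton.1 hs] using hq₂
  have uu22 := (boundedBy_col_endU (isWord_cons.2 ⟨hp₂, hq⟩)).1
  have uu23 := (boundedBy_col_endU (isWord_cons.2 ⟨hp₂, hl⟩)).1
  have uu32 := (boundedBy_col_endU hq).1
  have uu33 := (boundedBy_col_endU hl).1
  have uw23 := (boundedBy_col_endW (k := k + 1) (isWord_cons.2 ⟨hp₂, hl⟩) (by simp [hk])).1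
  have wu32 := (abs_col_endU_le (k := k + 1) hq (by simp [hk])).2
  have uw33 := (boundedBy_col_endW hl hk).1
  have wu33 := (abs_col_endU_le hl hk).2
  have ww33 := (boundedBy_col_endW hl hk).2.2
  have hd := two_mul_chainInc_le k
  have h0 := chainSum_nonneg (k + 3)
  have h1 : chainSum (k + 9) = 4 * chainSum (k + 5) + 8 * chainSum (k + 4)
      + 4 * chainSum (k + 3) := by
    simp only [chainSum_add_three]; ring
  have h2 : chainInc (k + 3) = chainSum (k + 4) - chainSum (k + 3) := rfl
  have h3 : chainInc (k + 4) = chainSum (k + 5) - chainSum (k + 4) := rfl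
  simp only [List.length_cons, List.length_append, List.length_nil, hk, zero_add,
    add_assoc, Nat.reduceAdd] at uu22 uu23 uu32 uu33 uw23 wu32
  simp only [col_cons, col_append_singleton] at *
  generalize col endU l = x at *
  generalize col endV l = y at *
  generalize col endW l = z at *
  generalize chainInc (k + 3) = v₃ at *
  generalize chainInc (k + 4) = v₄ at *
  generalize chainSum (k + 3) = u₃ at *
  generalize chainSum (k + 4) = u₄ at *
  generalize chainSum (k + 5) = u₅ at *
  generalize chainSum (k + 9) = u₉ at *
  obtain ⟨xu, xv, xw⟩ := x
  obtain ⟨yu, yv, yw⟩ := y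
  obtain ⟨zu, zv, zw⟩ := z
  simp only [transfer, Prod.fst_add, Prod.snd_add, Prod.fst_sub, Prod.snd_sub, Prod.smul_fst,
    Prod.smul_snd, smul_eq_mul, abs_le] at *
  apply abs_add_abs_le_of
  rcases hp₀ with rfl | rfl <;> rcases hp₁ with rfl | rfl <;> rcases hp₂ with rfl | rfl <;>
    rcases hq₀ with rfl | rfl <;> rcases hq₁ with rfl | rfl <;> rcases hq₂ with rfl | rfl <;>
    simp only [one_mul, neg_one_mul] at * <;> omega

lemma col_endU_replicate_fst : ∀ k, (col endU (List.replicate k 1)).1 = chainSum k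
  | 0 => by decide
  | 1 => by decide
  | 2 => by decide
  | k + 3 => by
    have h0 := col_endU_replicate_fst k
    have h1 := col_endU_replicate_fst (k + 1)
    rw [chainSum_add_three, ← h0, ← h1]
    simp only [List.replicate_succ, col_cons, transfer]
    ring

lemma col_endU_replicate_snd (k : ℕ) :
    (col endU (List.replicate k 1)).2.1 = chainInc k := by
  rw [chainInc, ← col_endU_replicate_fst, ← col_endU_replicate_fst]
  simp [List.replicate_succ, transfer]

lemma col_endV_replicate_fst (k : ℕ) :
    (col endV (List.replicate k 1)).1 = chainInc k := by
  rw [chainInc, ← col_endU_replicate_fst, ← col_endU_replicate_fst, List.replicate_succ',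
    (col_append_singleton _ _).1]
  simp

lemma col_endW_replicate (k : ℕ) :
    (col endW (List.replicate (k + 6) 1)).2.2 = 4 * chainSum k := by
  have h : List.replicate (k + 6) (1 : ℤ)
      = 1 :: 1 :: 1 :: (List.replicate k 1 ++ [1] ++ [1] ++ [1]) := by
    simp only [← List.replicate_succ', ← List.replicate_succ]
  rw [h, ← col_endU_replicate_fst]
  simp only [col_cons, col_append_singleton, transfer, Prod.fst_add, Prod.snd_add, Prod.fst_sub,
    Prod.snd_sub, Prod.smul_fst, Prod.smul_snd, smul_eq_mul]
  ring

/-- The sum over the four states of a closed chain, all terms counted positively. -/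
def absTrace (l : List ℤ) : ℤ :=
  |(col endU l).1| + |(col endU l).2.1| + |(col endV l).1| + |(col endW l).2.2|

/-- The trace of a closed chain with all signs equal to `1`. -/
def traceOne (k : ℕ) : ℤ :=
  (col endU (List.replicate k 1)).1 + (col endU (List.replicate k 1)).2.1
    + (col endV (List.replicate k 1)).1 + (col endW (List.replicate k 1)).2.2

lemma absTrace_le_of_lt_nine : ∀ k < 9, ∀ l ∈ words k, absTrace l ≤ traceOne k := by
  unfold absTrace traceOne
  decide +kernel

lemma exists_append_singleton {k : ℕ} {l : List ℤ} (hl : IsWord l) (hk : l.length = k + 1) :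
    ∃ l' s, l = l' ++ [s] ∧ IsWord l' ∧ (s = 1 ∨ s = -1) ∧ l'.length = k := by
  rcases List.eq_nil_or_concat' l with rfl | ⟨l', s, rfl⟩
  · simp at hk
  · exact ⟨l', s, rfl, fun t ht => hl t (by simp [ht]), hl s (by simp), by simpa using hk⟩

lemma absTrace_le {l : List ℤ} (hl : IsWord l) : absTrace l ≤ traceOne l.length := by
  rcases Nat.lt_or_ge l.length 9 with h | h
  · exact absTrace_le_of_lt_nine _ h l hl.mem_words
  obtain ⟨k, hk⟩ := Nat.exists_eq_add_of_le' h
  have hv := (abs_col_endU_le (k := k + 6) hl hk).1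
  have hu := (boundedBy_col_endV (k := k + 6) hl hk).1
  have hw : |(col endU l).1| + |(col endW l).2.2| ≤ chainSum (k + 9) + 4 * chainSum (k + 3) := by
    match l, hl, hk with
    | p₀ :: p₁ :: p₂ :: l, hl, hk =>
      simp only [isWord_cons] at hl
      simp only [List.length_cons] at hk
      obtain ⟨hp₀, hp₁, hp₂, hl⟩ := hl
      obtain ⟨l, q₀, rfl, hl, hq₀, hk⟩ := exists_append_singleton (k := k + 5) hl (by omega)
      obtain ⟨l, q₁, rfl, hl, hq₁, hk⟩ := exists_append_singleton hl hk
      obtain ⟨l, q₂, rfl, hl, hq₂, hk⟩ := exists_append_singleton hl hk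
      exact abs_col_endU_add_abs_col_endW_le hp₀ hp₁ hp₂ hq₀ hq₁ hq₂ hl hk
    | [], _, hk => simp at hk
    | [_], _, hk => simp at hk
    | [_, _], _, hk => simp at hk
  simp only [add_assoc, Nat.reduceAdd] at hv hu
  rw [absTrace, traceOne, hk, col_endU_replicate_fst, col_endU_replicate_snd,
    col_endV_replicate_fst, col_endW_replicate (k + 3)]
  omega

/-- The phase of the chain with states `a b` before and `y z` after the variables `x`. -/
def chainPhase : (m : ℕ) → ZMod 2 → ZMod 2 → (Fin m → ZMod 2) → (Fin m → ZMod 2) →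
    ZMod 2 → ZMod 2 → ZMod 2
  | 0, a, b, _, _, y, z => a * b * y + b * y * z
  | m + 1, a, b, c, x, y, z =>
    a * b * x 0 + c 0 * x 0 + chainPhase m b (x 0) (Fin.tail c) (Fin.tail x) y z

/-- The component of a triple of chain sums belonging to the initial state `a b`. -/
def atState (a b : ZMod 2) (r : ℤ × ℤ × ℤ) : ℤ :=
  if b = 0 then r.1 else if a = 0 then r.2.1 else r.2.2

/-- The terminal data of the state `y z`. -/
def endState (y z : ZMod 2) : ℤ × ℤ × ℤ :=
  if y = 0 then endU else if z = 0 then endV else endW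

/-- The word of signs of a vector of bits. -/
def signs {m : ℕ} (c : Fin m → ZMod 2) : List ℤ := List.ofFn fun i => (-1) ^ (c i).val

lemma neg_one_pow_val_add (a b : ZMod 2) :
    (-1 : ℤ) ^ (a + b).val = (-1) ^ a.val * (-1) ^ b.val := by
  revert a b; decide

lemma neg_one_pow_val (a : ZMod 2) : (-1 : ℤ) ^ a.val = 1 ∨ (-1 : ℤ) ^ a.val = -1 :=
  neg_one_pow_eq_or ℤ _

lemma isWord_signs {m : ℕ} (c : Fin m → ZMod 2) : IsWord (signs c) := by
  intro s hs
  obtain ⟨i, rfl⟩ := (List.mem_ofFn' _ _).1 hs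
  exact neg_one_pow_val _

lemma sum_zmod_two {M : Type*} [AddCommMonoid M] (f : ZMod 2 → M) : ∑ a, f a = f 0 + f 1 :=
  Fin.sum_univ_two f

lemma sum_cons {m : ℕ} (f : (Fin (m + 1) → ZMod 2) → ℤ) :
    ∑ x, f x = ∑ a, ∑ x, f (Fin.cons a x) := by
  rw [← Fintype.sum_prod_type', ← (Fin.consEquiv fun _ : Fin (m + 1) => ZMod 2).sum_comp]
  rfl

lemma sum_chainPhase (m : ℕ) (c : Fin m → ZMod 2) (a b y z : ZMod 2) :
    ∑ x, (-1 : ℤ) ^ (chainPhase m a b c x y z).val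
      = atState a b (col (endState y z) (signs c)) := by
  induction m generalizing a b with
  | zero =>
    simp only [chainPhase, signs, List.ofFn_zero, col_nil, Finset.univ_unique,
      Finset.sum_singleton]
    revert a b y z
    decide
  | succ m ih =>
    rw [sum_cons, sum_zmod_two]
    simp only [chainPhase, Fin.cons_zero, Fin.tail_cons, neg_one_pow_val_add, ← Finset.mul_sum, ih]
    rw [show signs c = (-1) ^ (c 0).val :: signs (Fin.tail c) from List.ofFn_succ, col_cons]
    generalize col _ _ = r
    generalize c 0 = s
    have h1 : (ZMod.val (1 : ZMod 2)) = 1 := rfl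
    have h2 : ∀ t : ZMod 2, t = 0 ∨ t = 1 := by decide
    rcases h2 a with rfl | rfl <;> rcases h2 b with rfl | rfl <;>
      simp [atState, transfer, h1, sub_eq_add_neg]

lemma chainPhase_eq (m : ℕ) (c x : Fin m → ZMod 2) (a b y z : ZMod 2) (w : ℕ → ZMod 2)
    (ha : w 0 = a) (hb : w 1 = b) (hx : ∀ i : Fin m, w (i + 2) = x i)
    (hy : w (m + 2) = y) (hz : w (m + 3) = z) :
    chainPhase m a b c x y z
      = (∑ i ∈ Finset.range (m + 2), w i * w (i + 1) * w (i + 2)) + ∑ i, c i * x i := by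
  induction m generalizing a b w with
  | zero => simp [chainPhase, Finset.sum_range_succ, ← ha, ← hb, ← hy, ← hz]
  | succ m ih =>
    rw [chainPhase, ih (Fin.tail c) (Fin.tail x) b (x 0) (fun i => w (i + 1)) hb (hx 0)
      (fun i => hx i.succ) hy hz, Finset.sum_range_succ' _ (m + 2), Fin.sum_univ_succ,
      show w 0 * w (0 + 1) * w (0 + 2) = a * b * x 0 by rw [ha, ← hb, ← hx 0]; rfl]
    simp only [Fin.tail]
    ring

lemma F3_add_dotp_cons_cons (m : ℕ) (c : Fin (m + 2) → ZMod 2) (a b : ZMod 2)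
    (x : Fin m → ZMod 2) :
    F3 (m + 2) (Fin.cons a (Fin.cons b x)) + dotp (m + 2) c (Fin.cons a (Fin.cons b x))
      = c 0 * a + c 1 * b + chainPhase m a b (Fin.tail (Fin.tail c)) x a b := by
  set X : Fin (m + 2) → ZMod 2 := Fin.cons a (Fin.cons b x)
  have hlt (i : ℕ) : i % (m + 2) < m + 2 := Nat.mod_lt _ (by omega)
  have h0 : X ⟨0, by omega⟩ = a := rfl
  have h1 : X ⟨1, by omega⟩ = b := rfl
  have hdot : dotp (m + 2) c X = c 0 * a + c 1 * b + ∑ i, Fin.tail (Fin.tail c) i * x i := by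
    rw [dotp, Fin.sum_univ_succ, Fin.sum_univ_succ, ← add_assoc]
    rfl
  have hF : F3 (m + 2) X = ∑ i ∈ Finset.range (m + 2), X ⟨i % (m + 2), hlt i⟩
      * X ⟨(i + 1) % (m + 2), hlt (i + 1)⟩ * X ⟨(i + 2) % (m + 2), hlt (i + 2)⟩ := by
    rw [F3, Finset.sum_range]
    simp only [Nat.mod_eq_of_lt (Fin.is_lt _)]
  rw [chainPhase_eq m _ x a b a b (fun i => X ⟨i % (m + 2), hlt i⟩), hdot, hF]
  · ring
  · simpa using h0
  · simpa [Nat.mod_eq_of_lt (show 1 < m + 2 by omega)] using h1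
  · intro i
    simp only [Nat.mod_eq_of_lt (show i.val + 2 < m + 2 by omega)]
    rfl
  · simpa using h0
  · simpa [show (m + 3) % (m + 2) = 1 by
      rw [show m + 3 = 1 + (m + 2) by ring, Nat.add_mod_right, Nat.mod_eq_of_lt (by omega)]]
      using h1

lemma walsh_F3 (m : ℕ) (c : Fin (m + 2) → ZMod 2) :
    walsh (m + 2) (F3 (m + 2)) c =
      (col endU (signs (Fin.tail (Fin.tail c)))).1
      + (-1) ^ (c 1).val * (col endU (signs (Fin.tail (Fin.tail c)))).2.1
      + (-1) ^ (c 0).val * (col endV (signs (Fin.tail (Fin.tail c)))).1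
      + (-1) ^ (c 0).val * (-1) ^ (c 1).val
        * (col endW (signs (Fin.tail (Fin.tail c)))).2.2 := by
  rw [walsh, sum_cons]
  simp only [sum_cons (m := m), F3_add_dotp_cons_cons m]
  simp only [neg_one_pow_val_add, ← Finset.mul_sum, sum_chainPhase, sum_zmod_two]
  simp [atState, endState]
  ring

/-- For every `n ≥ 3`, `F̂_3^n(0) = max { |F̂_3^n(c)| : c ∈ F_2^n }`. -/
theorem stmt_2 (n : ℕ) (hn : 3 ≤ n) :
    walsh n (F3 n) 0
      = Finset.univ.sup' Finset.univ_nonempty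
          (fun c : Fin n → ZMod 2 => |walsh n (F3 n) c|) := by
  obtain ⟨m, rfl⟩ := Nat.exists_eq_add_of_le' (show 2 ≤ n by omega)
  have hzero : walsh (m + 2) (F3 (m + 2)) 0 = traceOne m := by
    have h : signs (Fin.tail (Fin.tail (0 : Fin (m + 2) → ZMod 2))) = List.replicate m 1 := by
      simp [signs, Fin.tail, List.ofFn_const]
    rw [walsh_F3 m, h, traceOne]
    simp
  have hle (c : Fin (m + 2) → ZMod 2) :
      |walsh (m + 2) (F3 (m + 2)) c| ≤ walsh (m + 2) (F3 (m + 2)) 0 := by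
    have h := absTrace_le (isWord_signs (Fin.tail (Fin.tail c)))
    rw [show (signs (Fin.tail (Fin.tail c))).length = m by simp [signs]] at h
    rw [hzero, walsh_F3 m]
    refine le_trans ?_ h
    refine (abs_add_le _ _).trans (add_le_add ((abs_add_le _ _).trans
      (add_le_add ((abs_add_le _ _).trans (add_le_add le_rfl ?_)) ?_)) ?_) <;>
      simp [abs_mul]
  apply le_antisymm
  · exact (le_abs_self _).trans
      (Finset.le_sup' (fun c => |walsh (m + 2) (F3 (m + 2)) c|) (Finset.mem_univ 0))
  · exact Finset.sup'_le _ _ fun c _ => hle c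
end

section
/- For every n ≥ 5, Σ_{x ∈ F_2^n} (−1)^{F_3^n(x)} = Σ_{y ∈ F_2^{n−2}} Σ_{i=0}^{3} (−1)^{f_i^{n−2}(y)}; equivalently F̂_3^n(0) = f̂_0^{n−2}(0) + f̂_1^{n−2}(0) + f̂_2^{n−2}(0) + f̂_3^{n−2}(0), where 0 denotes the zero vector. -/
theorem tm_eq_sum_range (k : ℕ) (y : ℕ → ZMod 2) :
    tm (k + 3) (fun i => y i) = ∑ i ∈ Finset.range (k + 1), y i * y (i + 1) * y (i + 2) := by
  unfold tm
  rw [Finset.sum_range_succ, Finset.sum_range_succ]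
  simp only [show ¬ (k + 1 + 2 < k + 3) by omega, show ¬ (k + 2 + 2 < k + 3) by omega,
    dite_false, add_zero]
  refine Finset.sum_congr rfl fun i hi => ?_
  have h : i + 2 < k + 3 := by simp only [Finset.mem_range] at hi; omega
  simp [h]

theorem F3_eq_tm (k : ℕ) (y : ℕ → ZMod 2) :
    F3 (k + 5) (fun i => y i) = tm (k + 3) (fun i => y i) + y (k + 1) * y (k + 2) * y (k + 3)
      + y (k + 2) * y (k + 3) * y (k + 4) + y (k + 3) * y (k + 4) * y 0
      + y (k + 4) * y 0 * y 1 := by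
  rw [tm_eq_sum_range]
  unfold F3
  rw [Fin.sum_univ_eq_sum_range
    (fun i => y i * y ((i + 1) % (k + 5)) * y ((i + 2) % (k + 5))) (k + 5)]
  iterate 4 rw [Finset.sum_range_succ]
  have h : ∀ i, i < k + 5 → i % (k + 5) = i := fun i hi => Nat.mod_eq_of_lt hi
  have h0 : (k + 5) % (k + 5) = 0 := Nat.mod_self _
  have h1 : (k + 6) % (k + 5) = 1 := by
    rw [show k + 6 = 1 + (k + 5) by omega, Nat.add_mod_right, h 1 (by omega)]
  simp only [add_assoc, Nat.reduceAdd, h (k + 2) (by omega), h (k + 3) (by omega),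
    h (k + 4) (by omega), h0, h1]
  congr 1
  refine Finset.sum_congr rfl fun i hi => ?_
  rw [Finset.mem_range] at hi
  rw [h (i + 1) (by omega), h (i + 2) (by omega)]

/-- Splitting off the last two coordinates of the argument of `F3`. -/
theorem F3_snoc_snoc (k : ℕ) (y : Fin (k + 3) → ZMod 2) (a b : ZMod 2) :
    F3 (k + 5) (Fin.snoc (α := fun _ => ZMod 2) (Fin.snoc (α := fun _ => ZMod 2) y a) b)
      = tm (k + 3) y + y ⟨k + 1, by omega⟩ * y ⟨k + 2, by omega⟩ * a
        + y ⟨k + 2, by omega⟩ * a * b + a * b * y 0 + b * y 0 * y ⟨1, by omega⟩ := by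
  let Y : ℕ → ZMod 2 := fun i =>
    if h : i < k + 3 then y ⟨i, h⟩ else if i < k + 4 then a else b
  have hY : ∀ i (h : i < k + 3), Y i = y ⟨i, h⟩ := fun i h => dif_pos h
  have ha : Y (k + 3) = a := by simp [Y]
  have hb : Y (k + 4) = b := by simp [Y]
  have hy : y = fun i : Fin (k + 3) => Y i := funext fun i => (hY i i.isLt).symm
  have hx : Fin.snoc (α := fun _ => ZMod 2) (Fin.snoc (α := fun _ => ZMod 2) y a) b
      = fun i : Fin (k + 5) => Y i := by
    funext i
    refine Fin.lastCases ?_ (fun j => ?_) i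
    · simp [hb]
    · refine Fin.lastCases ?_ (fun l => ?_) j
      · simp [ha]
      · simp [hY l (by omega)]
  rw [hx, F3_eq_tm, ha, hb, ← hy, hY 0 (by omega), hY 1 (by omega), hY (k + 1) (by omega),
    hY (k + 2) (by omega)]
  rfl

theorem sum_fin_succ_pi_snoc {m : ℕ} {α M : Type*} [Fintype α] [AddCommMonoid M]
    (g : (Fin (m + 1) → α) → M) :
    ∑ x, g x = ∑ y : Fin m → α, ∑ a : α, g (Fin.snoc (α := fun _ => α) y a) := by
  rw [← (Fin.snocEquiv fun _ : Fin (m + 1) => α).sum_comp, Fintype.sum_prod_type_right]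
  rfl

theorem sum_neg_one_pow_F3 (k : ℕ) :
    ∑ x : Fin (k + 5) → ZMod 2, (-1 : ℤ) ^ (F3 (k + 5) x).val
      = ∑ y : Fin (k + 3) → ZMod 2,
          ((-1 : ℤ) ^ (f0 (k + 3) y).val + (-1 : ℤ) ^ (f1 (k + 3) y).val
            + (-1 : ℤ) ^ (f2 (k + 3) y).val + (-1 : ℤ) ^ (f3 (k + 3) y).val) := by
  rw [sum_fin_succ_pi_snoc, sum_fin_succ_pi_snoc]
  refine Finset.sum_congr rfl fun y _ => ?_
  have hsum : ∀ g : ZMod 2 → ℤ, ∑ a, g a = g 0 + g 1 := fun g => Fin.sum_univ_two g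
  simp only [hsum, F3_snoc_snoc]
  have e0 : f0 (k + 3) y = tm (k + 3) y := rfl
  have e1 : f1 (k + 3) y = tm (k + 3) y + y 0 * y ⟨1, by omega⟩ := dif_pos (by omega)
  have e2 : f2 (k + 3) y = tm (k + 3) y + y ⟨k + 1, by omega⟩ * y ⟨k + 2, by omega⟩ :=
    dif_pos (by omega)
  have e3 : f3 (k + 3) y = tm (k + 3) y + y 0 * y ⟨1, by omega⟩
      + y ⟨k + 1, by omega⟩ * y ⟨k + 2, by omega⟩ + y 0 + y ⟨k + 2, by omega⟩ :=
    dif_pos (by omega)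
  rw [e0, e1, e2, e3]
  ring_nf

theorem walsh_zero (n : ℕ) (f : (Fin n → ZMod 2) → ZMod 2) :
    walsh n f 0 = ∑ x, (-1 : ℤ) ^ (f x).val := by
  simp [walsh, dotp]

/-- For every `n ≥ 5`,
`Σ_x (−1)^{F_3^n(x)} = Σ_y Σ_{i=0}^3 (−1)^{f_i^{n−2}(y)}`; equivalently
`F̂_3^n(0) = f̂_0^{n−2}(0) + f̂_1^{n−2}(0) + f̂_2^{n−2}(0) + f̂_3^{n−2}(0)`. -/
theorem stmt_5 (n : ℕ) (hn : 5 ≤ n) :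
    (∑ x : Fin n → ZMod 2, (-1 : ℤ) ^ (F3 n x).val
        = ∑ y : Fin (n - 2) → ZMod 2,
            ((-1 : ℤ) ^ (f0 (n - 2) y).val + (-1 : ℤ) ^ (f1 (n - 2) y).val
              + (-1 : ℤ) ^ (f2 (n - 2) y).val + (-1 : ℤ) ^ (f3 (n - 2) y).val))
    ∧ walsh n (F3 n) 0
        = walsh (n - 2) (f0 (n - 2)) 0 + walsh (n - 2) (f1 (n - 2)) 0
          + walsh (n - 2) (f2 (n - 2)) 0 + walsh (n - 2) (f3 (n - 2)) 0 := by
  obtain ⟨k, rfl⟩ : ∃ k, n = k + 5 := ⟨n - 5, by omega⟩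
  refine ⟨sum_neg_one_pow_F3 k, ?_⟩
  simp only [walsh_zero, ← Finset.sum_add_distrib]
  exact sum_neg_one_pow_F3 k
end

section
/- For every n ≥ 6 and every c = (c_0,…,c_{n−1}) ∈ F_2^n with c_{n−1} = 0, f̂_0^n(c) = 2·( f̂_0^{n−2}(c^{n−2}) + (−1)^{c_{n−2}} · f̂_0^{n−3}(c^{n−3}) ), where c^m denotes the vector of the first m coordinates of c. -/
theorem sum_fin_succ_zmod_two {M : Type*} [AddCommMonoid M] (k : ℕ)
    (g : (Fin (k + 1) → ZMod 2) → M) :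
    ∑ x, g x = ∑ y : Fin k → ZMod 2,
      (g (Fin.snoc (α := fun _ => ZMod 2) y 0) + g (Fin.snoc (α := fun _ => ZMod 2) y 1)) := by
  rw [← (Fin.snocEquiv fun _ : Fin (k + 1) => ZMod 2).sum_comp g, Fintype.sum_prod_type_right]
  exact Finset.sum_congr rfl fun y _ => Fin.sum_univ_two _

theorem dotp_snoc (k : ℕ) (c : Fin (k + 1) → ZMod 2) (y : Fin k → ZMod 2) (a : ZMod 2) :
    dotp (k + 1) c (Fin.snoc (α := fun _ => ZMod 2) y a)
      = dotp k (fun i => c i.castSucc) y + c (Fin.last k) * a := by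
  simp [dotp, Fin.sum_univ_castSucc]

theorem tm_snoc (j : ℕ) (y : Fin (j + 2) → ZMod 2) (a : ZMod 2) :
    tm (j + 3) (Fin.snoc (α := fun _ => ZMod 2) y a)
      = tm (j + 2) y + y (Fin.last j).castSucc * y (Fin.last (j + 1)) * a := by
  simp only [tm]
  rw [Finset.sum_range_succ, Finset.sum_range_succ, Finset.sum_range_succ,
    Finset.sum_range_succ _ (j + 1), Finset.sum_range_succ _ j]
  have h : ∀ i ∈ Finset.range j,
      (if h : i + 2 < j + 3 then
        Fin.snoc (α := fun _ => ZMod 2) y a ⟨i, by omega⟩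
          * Fin.snoc (α := fun _ => ZMod 2) y a ⟨i + 1, by omega⟩
          * Fin.snoc (α := fun _ => ZMod 2) y a ⟨i + 2, by omega⟩ else 0)
      = if h : i + 2 < j + 2 then
        y ⟨i, by omega⟩ * y ⟨i + 1, by omega⟩ * y ⟨i + 2, by omega⟩ else 0 := by
    intro i hi
    have hi := Finset.mem_range.mp hi
    rw [dif_pos (by omega), dif_pos (by omega)]
    simp [Fin.snoc, hi, show i < j + 2 by omega, show i + 1 < j + 2 by omega]
  rw [Finset.sum_congr rfl h]
  simp [Fin.snoc, Fin.last]

theorem walsh_f0_add_five (j : ℕ) (c : Fin (j + 5) → ZMod 2) (hc : c (Fin.last (j + 4)) = 0) :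
    walsh (j + 5) (f0 (j + 5)) c
      = 2 * (walsh (j + 3) (f0 (j + 3)) (fun i => c i.castSucc.castSucc)
          + (-1 : ℤ) ^ (c (Fin.last (j + 3)).castSucc).val
            * walsh (j + 2) (f0 (j + 2)) (fun i => c i.castSucc.castSucc.castSucc)) := by
  simp only [walsh, f0, sum_fin_succ_zmod_two (j + 4), sum_fin_succ_zmod_two (j + 3),
    sum_fin_succ_zmod_two (j + 2)]
  rw [Finset.mul_sum, ← Finset.sum_add_distrib, Finset.mul_sum]
  refine Finset.sum_congr rfl fun y _ => ?_
  simp only [tm_snoc, dotp_snoc, hc, Fin.snoc_last, Fin.snoc_castSucc]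
  generalize tm (j + 2) y = t, dotp (j + 2) _ y = s, y (Fin.last (j + 1)) = v,
    y (Fin.last j).castSucc = u, c (Fin.last (j + 3)).castSucc = q,
    c (Fin.last (j + 2)).castSucc.castSucc = p
  revert t s v u q p
  decide

/-- For every `n ≥ 6` and `c ∈ F_2^n` with `c_{n−1} = 0`,
`f̂_0^n(c) = 2(f̂_0^{n−2}(c^{n−2}) + (−1)^{c_{n−2}} f̂_0^{n−3}(c^{n−3}))`. -/
theorem stmt_6 (n : ℕ) (hn : 6 ≤ n) (c : Fin n → ZMod 2)
    (hc : c ⟨n - 1, by omega⟩ = 0) :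
    walsh n (f0 n) c
      = 2 * (walsh (n - 2) (f0 (n - 2)) (trunc (n - 2) (by omega) c)
          + (-1 : ℤ) ^ (c ⟨n - 2, by omega⟩).val
              * walsh (n - 3) (f0 (n - 3)) (trunc (n - 3) (by omega) c)) := by
  obtain ⟨j, rfl⟩ : ∃ j, n = j + 5 := ⟨n - 5, by omega⟩
  exact walsh_f0_add_five j c hc
end

section
/- For every n ≥ 8 and every c = (c_0,…,c_{n−1}) ∈ F_2^n with c_{n−1} = 1: if c_{n−2} = 0 then f̂_3^n(c) = f̂_1^{n−1}(c^{n−1} + e_1) + 2(−1)^{c_{n−3}} f̂_1^{n−4}(c^{n−4} + e_1); if c_{n−2} = 1 and c_{n−3} = 0 then f̂_3^n(c) = f̂_1^{n−1}(c^{n−1} + e_1) + 2 f̂_1^{n−4}(c^{n−4} + e_1) + 4(−1)^{c_{n−4}} f̂_1^{n−5}(c^{n−5} + e_1); if c_{n−2} = 1 and c_{n−3} = 1 then f̂_3^n(c) = f̂_1^{n−1}(c^{n−1} + e_1) + 2 f̂_1^{n−4}(c^{n−4} + e_1) + 4(−1)^{c_{n−4}+c_{n−5}} f̂_3^{n−5}(c^{n−5}).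 -/
theorem ZMod.sum_two {M : Type*} [AddCommMonoid M] (g : ZMod 2 → M) : ∑ b, g b = g 0 + g 1 :=
  Fin.sum_univ_two g

theorem sum_fin_succ_eq_sum_snoc (m : ℕ) (g : (Fin (m + 1) → ZMod 2) → ℤ) :
    ∑ x, g x = ∑ x : Fin m → ZMod 2, (g (Fin.snoc x 0) + g (Fin.snoc x 1)) := by
  rw [← (Fin.snocEquiv fun _ : Fin (m + 1) => ZMod 2).sum_comp, Fintype.sum_prod_type_right]
  exact Finset.sum_congr rfl fun x _ => ZMod.sum_two fun b => g (Fin.snoc x b)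

theorem snoc_mk_of_lt {m i : ℕ} (h : i < m) (x : Fin m → ZMod 2) (b : ZMod 2) :
    (Fin.snoc x b : Fin (m + 1) → ZMod 2) ⟨i, Nat.lt_succ_of_lt h⟩ = x ⟨i, h⟩ :=
  Fin.snoc_castSucc (α := fun _ => ZMod 2) b x ⟨i, h⟩

theorem snoc_mk_self {m : ℕ} (x : Fin m → ZMod 2) (b : ZMod 2) :
    (Fin.snoc x b : Fin (m + 1) → ZMod 2) ⟨m, Nat.lt_succ_self m⟩ = b :=
  Fin.snoc_last (α := fun _ => ZMod 2) b x

theorem snoc_snoc_mk_self {m : ℕ} (h : m < m + 2) (x : Fin m → ZMod 2) (a b : ZMod 2) :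
    (Fin.snoc (Fin.snoc x a : Fin (m + 1) → ZMod 2) b : Fin (m + 2) → ZMod 2) ⟨m, h⟩ = a :=
  (snoc_mk_of_lt (Nat.lt_succ_self m) _ b).trans (snoc_mk_self x a)

theorem tm_snoc_s13 (m : ℕ) (x : Fin (m + 2) → ZMod 2) (b : ZMod 2) :
    tm (m + 3) (Fin.snoc x b)
      = tm (m + 2) x + x ⟨m, by omega⟩ * x ⟨m + 1, by omega⟩ * b := by
  unfold tm
  rw [Finset.sum_range_succ, Finset.sum_range_succ, Finset.sum_range_succ,
    Finset.sum_range_succ, Finset.sum_range_succ]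
  have hsum : ∀ i ∈ Finset.range m,
      (if h : i + 2 < m + 3 then
        (Fin.snoc x b : Fin (m + 3) → ZMod 2) ⟨i, by omega⟩
          * (Fin.snoc x b : Fin (m + 3) → ZMod 2) ⟨i + 1, by omega⟩
          * (Fin.snoc x b : Fin (m + 3) → ZMod 2) ⟨i + 2, by omega⟩ else 0)
      = if h : i + 2 < m + 2 then
          x ⟨i, by omega⟩ * x ⟨i + 1, by omega⟩ * x ⟨i + 2, by omega⟩ else 0 := by
    intro i hi
    have hi := Finset.mem_range.mp hi
    rw [dif_pos (by omega), dif_pos (by omega), snoc_mk_of_lt (by omega),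
      snoc_mk_of_lt (by omega), snoc_mk_of_lt (by omega)]
  rw [Finset.sum_congr rfl hsum, dif_pos (by omega), dif_neg (by omega), dif_neg (by omega),
    dif_neg (by omega), dif_neg (by omega), snoc_mk_of_lt (by omega),
    snoc_mk_of_lt (by omega), snoc_mk_self]
  ring

theorem dotp_snoc_s13 (m : ℕ) (c : Fin (m + 1) → ZMod 2) (x : Fin m → ZMod 2) (b : ZMod 2) :
    dotp (m + 1) c (Fin.snoc x b)
      = dotp m (trunc m (Nat.le_succ m) c) x + c ⟨m, Nat.lt_succ_self m⟩ * b := by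
  simp only [dotp, Fin.sum_univ_castSucc, Fin.snoc_castSucc, Fin.snoc_last]
  rfl

theorem dotp_add_eOne (m : ℕ) (c x : Fin (m + 1) → ZMod 2) :
    dotp (m + 1) (c + eOne (m + 1)) x = dotp (m + 1) c x + x ⟨0, Nat.succ_pos m⟩ := by
  simp only [dotp, Pi.add_apply, add_mul, Finset.sum_add_distrib]
  congr 1
  simp [eOne]

theorem f1_add_two (m : ℕ) (x : Fin (m + 2) → ZMod 2) :
    f1 (m + 2) x = tm (m + 2) x + x ⟨0, by omega⟩ * x ⟨1, by omega⟩ :=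
  dif_pos (by omega)

theorem f3_add_two (m : ℕ) (x : Fin (m + 2) → ZMod 2) :
    f3 (m + 2) x = tm (m + 2) x + x ⟨0, by omega⟩ * x ⟨1, by omega⟩
      + x ⟨m, by omega⟩ * x ⟨m + 1, by omega⟩ + x ⟨0, by omega⟩ + x ⟨m + 1, by omega⟩ :=
  dif_pos (by omega)

/-- The sign `(-1) ^ a` of a bit `a`. -/
def bitSign (a : ZMod 2) : ℤ := (-1) ^ a.val

theorem bitSign_add (a b : ZMod 2) : bitSign (a + b) = bitSign a * bitSign b := by
  revert a b; decide

theorem bitSign_zero : bitSign 0 = 1 := rfl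

theorem bitSign_one : bitSign 1 = -1 := rfl

theorem walsh_eq_sum_bitSign (n : ℕ) (f : (Fin n → ZMod 2) → ZMod 2) (c : Fin n → ZMod 2) :
    walsh n f c = ∑ x, bitSign (f x + dotp n c x) := rfl

/-- The exponent in the transform of `f1` at `c^m + e_1` changes by a multiple of the last variable
when that variable is split off. -/
theorem f1_snoc_add_dotp {n : ℕ} (m : ℕ) (h : m + 3 ≤ n) (c : Fin n → ZMod 2)
    (x : Fin (m + 2) → ZMod 2) (b : ZMod 2) :
    f1 (m + 3) (Fin.snoc x b) + dotp (m + 3) (trunc (m + 3) h c + eOne (m + 3)) (Fin.snoc x b)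
      = f1 (m + 2) x + dotp (m + 2) (trunc (m + 2) (by omega) c + eOne (m + 2)) x
        + (x ⟨m, by omega⟩ * x ⟨m + 1, by omega⟩ + c ⟨m + 2, by omega⟩) * b := by
  rw [f1_add_two (m + 1), f1_add_two, tm_snoc_s13, dotp_add_eOne, dotp_add_eOne, dotp_snoc_s13,
    snoc_mk_of_lt (by omega), snoc_mk_of_lt (by omega)]
  change _ + _ + (dotp (m + 2) (trunc (m + 2) (by omega) c) x + c ⟨m + 2, by omega⟩ * b + _) = _
  ring

theorem f3_add_dotp (m : ℕ) (c x : Fin (m + 2) → ZMod 2) :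
    f3 (m + 2) x + dotp (m + 2) c x
      = f1 (m + 2) x + dotp (m + 2) (c + eOne (m + 2)) x
        + (x ⟨m, by omega⟩ + 1) * x ⟨m + 1, by omega⟩ := by
  rw [f1_add_two, f3_add_two, dotp_add_eOne]
  ring

/-- For every `n ≥ 8` and `c ∈ F_2^n` with `c_{n−1} = 1`, the three-case
recurrence for `f̂_3^n(c)` in terms of `f̂_1^{n−1}, f̂_1^{n−4}, f̂_1^{n−5}, f̂_3^{n−5}`. -/
theorem stmt_13 (n : ℕ) (hn : 8 ≤ n) (c : Fin n → ZMod 2)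
    (hc : c ⟨n - 1, by omega⟩ = 1) :
    (c ⟨n - 2, by omega⟩ = 0 →
      walsh n (f3 n) c
        = walsh (n - 1) (f1 (n - 1)) (trunc (n - 1) (by omega) c + eOne (n - 1))
          + 2 * (-1 : ℤ) ^ (c ⟨n - 3, by omega⟩).val
              * walsh (n - 4) (f1 (n - 4)) (trunc (n - 4) (by omega) c + eOne (n - 4)))
    ∧ (c ⟨n - 2, by omega⟩ = 1 → c ⟨n - 3, by omega⟩ = 0 →
      walsh n (f3 n) c
        = walsh (n - 1) (f1 (n - 1)) (trunc (n - 1) (by omega) c + eOne (n - 1))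
          + 2 * walsh (n - 4) (f1 (n - 4)) (trunc (n - 4) (by omega) c + eOne (n - 4))
          + 4 * (-1 : ℤ) ^ (c ⟨n - 4, by omega⟩).val
              * walsh (n - 5) (f1 (n - 5)) (trunc (n - 5) (by omega) c + eOne (n - 5)))
    ∧ (c ⟨n - 2, by omega⟩ = 1 → c ⟨n - 3, by omega⟩ = 1 →
      walsh n (f3 n) c
        = walsh (n - 1) (f1 (n - 1)) (trunc (n - 1) (by omega) c + eOne (n - 1))
          + 2 * walsh (n - 4) (f1 (n - 4)) (trunc (n - 4) (by omega) c + eOne (n - 4))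
          + 4 * (-1 : ℤ) ^ (c ⟨n - 4, by omega⟩ + c ⟨n - 5, by omega⟩).val
              * walsh (n - 5) (f3 (n - 5)) (trunc (n - 5) (by omega) c)) := by
  obtain ⟨k, rfl⟩ : ∃ k, n = k + 8 := ⟨n - 8, by omega⟩
  change c ⟨k + 7, _⟩ = 1 at hc
  change (c ⟨k + 6, _⟩ = 0 →
      walsh (k + 8) (f3 (k + 8)) c
        = walsh (k + 7) (f1 (k + 7)) (trunc (k + 7) _ c + eOne (k + 7))
          + 2 * bitSign (c ⟨k + 5, _⟩)
              * walsh (k + 4) (f1 (k + 4)) (trunc (k + 4) _ c + eOne (k + 4)))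
    ∧ (c ⟨k + 6, _⟩ = 1 → c ⟨k + 5, _⟩ = 0 →
      walsh (k + 8) (f3 (k + 8)) c
        = walsh (k + 7) (f1 (k + 7)) (trunc (k + 7) _ c + eOne (k + 7))
          + 2 * walsh (k + 4) (f1 (k + 4)) (trunc (k + 4) _ c + eOne (k + 4))
          + 4 * bitSign (c ⟨k + 4, _⟩)
              * walsh (k + 3) (f1 (k + 3)) (trunc (k + 3) _ c + eOne (k + 3)))
    ∧ (c ⟨k + 6, _⟩ = 1 → c ⟨k + 5, _⟩ = 1 →
      walsh (k + 8) (f3 (k + 8)) c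
        = walsh (k + 7) (f1 (k + 7)) (trunc (k + 7) _ c + eOne (k + 7))
          + 2 * walsh (k + 4) (f1 (k + 4)) (trunc (k + 4) _ c + eOne (k + 4))
          + 4 * bitSign (c ⟨k + 4, _⟩ + c ⟨k + 3, _⟩)
              * walsh (k + 3) (f3 (k + 3)) (trunc (k + 3) _ c))
  simp only [walsh_eq_sum_bitSign, sum_fin_succ_eq_sum_snoc (k + 7),
    sum_fin_succ_eq_sum_snoc (k + 6), sum_fin_succ_eq_sum_snoc (k + 5),
    sum_fin_succ_eq_sum_snoc (k + 4), sum_fin_succ_eq_sum_snoc (k + 3),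
    Finset.mul_sum, ← Finset.sum_add_distrib]
  have e4 := f1_snoc_add_dotp (k + 1) (by omega) c
  have e5 := f1_snoc_add_dotp (k + 2) (by omega) c
  have e6 := f1_snoc_add_dotp (k + 3) (by omega) c
  have e7 := f1_snoc_add_dotp (k + 4) (by omega) c
  have e8 := f1_snoc_add_dotp (k + 5) (by omega) c
  have g8 (x) : f3 (k + 8) x + dotp (k + 8) c x = f1 (k + 8) x +
      dotp (k + 8) (trunc (k + 8) le_rfl c + eOne (k + 8)) x +
        (x ⟨k + 6, by omega⟩ + 1) * x ⟨k + 7, by omega⟩ := f3_add_dotp (k + 6) c x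
  have g3 := f3_add_dotp (k + 1) (trunc (k + 3) (by omega) c)
  simp only [Nat.add_assoc, Nat.reduceAdd] at e4 e5 e6 e7 e8 g8 g3
  have hx (x : Fin (k + 3) → ZMod 2) (a : ZMod 2) :
      (Fin.snoc x a : Fin (k + 4) → ZMod 2) ⟨k + 2, by omega⟩ = x ⟨k + 2, by omega⟩ := snoc_mk_of_lt (by omega) x a
  simp only [g8, g3, e8, e7, e6, e5, e4, snoc_mk_self, snoc_snoc_mk_self, hx, hc]
  refine ⟨fun h6 => Fintype.sum_congr _ _ fun x => ?_,
    fun h6 h5 => Fintype.sum_congr _ _ fun x => ?_,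
    fun h6 h5 => Fintype.sum_congr _ _ fun x => ?_⟩
  all_goals
    simp only [h6, mul_zero, mul_one, zero_add, add_zero, add_mul, one_mul, bitSign_add,
      bitSign_one]
    try simp only [h5, bitSign_zero, bitSign_one]
    ring
end
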